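/- arXiv:2211.13875 — 5 statements merged into one kernel-verified Lean document; each statement's English description precedes it below -/
import Mathlib

section
/- For every integer n ≥ 1, the group of real-algebra automorphisms of the product algebra ℂ^(2^(n-1)) has exactly 2^(2^(n-1)) · (2^(n-1))! elements. -/
/-- An algebra homomorphism from a finite power of `A` to a domain factors through a coordinate
projection. -/
theorem exists_algHom_comp_eval {R A B ι : Type*} [CommSemiring R] [Semiring A] [Semiring B]
    [IsDomain B] [Algebra R A] [Algebra R B] [Finite ι] (f : (ι → A) →ₐ[R] B) :
    ∃ (i : ι) (g : A →ₐ[R] B), ∀ x, f x = g (x i) := by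
  classical
  cases nonempty_fintype ι
  obtain ⟨i, hi⟩ : ∃ i, f (Pi.single i 1) ≠ 0 := by
    by_contra! h
    have h1 : f (∑ i, Pi.single i 1) = 0 := by simp [map_sum, h]
    rw [Finset.univ_sum_single (fun _ : ι => (1 : A))] at h1
    exact one_ne_zero ((map_one f).symm.trans h1)
  refine ⟨i, f.comp (Pi.constAlgHom R ι A), fun x => mul_right_cancel₀ hi ?_⟩
  rw [AlgHom.comp_apply, ← map_mul, ← map_mul]
  congr 1
  ext j
  obtain rfl | hj := eq_or_ne j i <;> simp [*]

/-- The automorphism of `ι → L` permuting the coordinates by `σ` and applying `g i` to the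
`i`-th one. -/
def piAlgEquiv {K L ι : Type*} [CommSemiring K] [Semiring L] [Algebra K L]
    (p : Equiv.Perm ι × (ι → (L ≃ₐ[K] L))) : (ι → L) ≃ₐ[K] (ι → L) :=
  (AlgEquiv.piCongrLeft' K (fun _ : ι => L) p.1.symm).trans (AlgEquiv.piCongrRight p.2)

theorem piAlgEquiv_injective {K L ι : Type*} [CommSemiring K] [Semiring L] [Nontrivial L]
    [Algebra K L] :
    Function.Injective (piAlgEquiv : Equiv.Perm ι × (ι → (L ≃ₐ[K] L)) → _) := by
  classical
  rintro ⟨σ, g⟩ ⟨τ, h⟩ hgh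
  have key (x : ι → L) (i : ι) : g i (x (σ i)) = h i (x (τ i)) :=
    congrFun (DFunLike.congr_fun hgh x) i
  refine Prod.ext (Equiv.ext fun i => ?_) (funext fun i => AlgEquiv.ext fun a => ?_)
  · by_contra hne
    have := key (Pi.single (σ i) 1) i
    rw [Pi.single_eq_same, Pi.single_eq_of_ne (Ne.symm hne), map_one, map_zero] at this
    exact one_ne_zero this
  · exact key (fun _ => a) i

theorem piAlgEquiv_surjective {K L ι : Type*} [CommSemiring K] [DivisionRing L] [Algebra K L]
    [Finite ι] :
    Function.Surjective (piAlgEquiv : Equiv.Perm ι × (ι → (L ≃ₐ[K] L)) → _) := by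
  classical
  intro f
  choose σ g hg using fun i =>
    exists_algHom_comp_eval ((Pi.evalAlgHom K (fun _ : ι => L) i).comp f.toAlgHom)
  replace hg (i : ι) (x : ι → L) : f x i = g i (x (σ i)) := hg i x
  have hσ : Function.Injective σ := by
    intro i j hij
    by_contra hne
    obtain ⟨x, hx⟩ := f.surjective (Pi.single i 1)
    have hi := hg i x
    have hj := hg j x
    rw [hx, Pi.single_eq_same] at hi
    rw [hx, Pi.single_eq_of_ne (Ne.symm hne), ← hij, eq_comm,
      map_eq_zero_iff (g j) (g j).toRingHom.injective] at hj
    rw [hj, map_zero] at hi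
    exact one_ne_zero hi
  have hsurj (i : ι) : Function.Surjective (g i) := by
    intro a
    obtain ⟨x, hx⟩ := f.surjective fun _ => a
    exact ⟨x (σ i), by rw [← hg, hx]⟩
  refine ⟨(Equiv.ofBijective σ (Finite.injective_iff_bijective.mp hσ),
    fun i => AlgEquiv.ofBijective (g i) ⟨(g i).toRingHom.injective, hsurj i⟩), ?_⟩
  ext x i
  exact (hg i x).symm

theorem card_algEquiv_pi (K L ι : Type*) [CommSemiring K] [DivisionRing L] [Algebra K L]
    [Finite ι] :
    Nat.card ((ι → L) ≃ₐ[K] (ι → L)) =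
      Nat.card (L ≃ₐ[K] L) ^ Nat.card ι * (Nat.card ι).factorial := by
  rw [← Nat.card_congr (Equiv.ofBijective (piAlgEquiv : Equiv.Perm ι × (ι → (L ≃ₐ[K] L)) → _)
      ⟨piAlgEquiv_injective, piAlgEquiv_surjective⟩),
    Nat.card_prod, Nat.card_perm, Nat.card_fun, mul_comm]

theorem Complex.card_algEquiv_real : Nat.card (ℂ ≃ₐ[ℝ] ℂ) = 2 := by
  have : IsAlgClosure ℝ ℂ := ⟨inferInstance, inferInstance⟩
  have : Normal ℝ ℂ := IsAlgClosure.normal ℝ ℂ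
  have : IsGalois ℝ ℂ := ⟨⟩
  rw [IsGalois.card_aut_eq_finrank, Complex.finrank_real_complex]

/-- For each `n ≥ 1`, there are `2^(2^(n-1)) · (2^(n-1))!` real-algebra automorphisms of
`ℂ^(2^(n-1))`. -/
theorem card_automorphisms (n : ℕ) (hn : 1 ≤ n) :
    Nat.card ((Fin (2 ^ (n - 1)) → ℂ) ≃ₐ[ℝ] (Fin (2 ^ (n - 1)) → ℂ)) =
      2 ^ 2 ^ (n - 1) * (2 ^ (n - 1)).factorial := by
  rw [card_algEquiv_pi, Complex.card_algEquiv_real, Nat.card_fin]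
end

section
/- Let g : ℕ → ℕ satisfy g(1) = 2, g(2) = 6, and g(n) = 2·g(n-1) + (2n-2)·g(n-2) for all n ≥ 3. Then for every integer n ≥ 1, the number of involutions of MC(n), i.e. real-algebra automorphisms f of ℂ^(2^(n-1)) with f ∘ f = id, equals g(2^(n-1)). -/
/-- Pairs of an involutive self-map of `α` and a two-colouring of `α` invariant under it. -/
abbrev ColouredInvolution (α : Type*) : Type _ :=
  {p : (α → α) × (α → Bool) // Function.Involutive p.1 ∧ ∀ x, p.2 (p.1 x) = p.2 x}

namespace ColouredInvolution

/-- Transport of coloured involutions along an equivalence. -/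
def congr {α β : Type*} (e : α ≃ β) : ColouredInvolution α ≃ ColouredInvolution β where
  toFun p := ⟨(fun x => e (p.1.1 (e.symm x)), fun x => p.1.2 (e.symm x)),
    fun x => by simp [p.2.1 _], fun x => by simp [p.2.2 _]⟩
  invFun p := ⟨(fun x => e.symm (p.1.1 (e x)), fun x => p.1.2 (e x)),
    fun x => by simp [p.2.1 _], fun x => by simp [p.2.2 _]⟩
  left_inv p := by ext <;> simp
  right_inv p := by ext <;> simp

/-- Removing the orbit `{a, b}` from a coloured involution that swaps `a` and `b`. -/
def fiberEquiv {α : Type*} [DecidableEq α] (a b : α) (c : Bool) :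
    {p : ColouredInvolution α // (p.1.1 a, p.1.2 a) = (b, c)} ≃
      ColouredInvolution {x : α // x ≠ a ∧ x ≠ b} where
  toFun p := ⟨(fun x => ⟨p.1.1.1 x, by
      have hx := x.2
      have hp := p.2
      have hi := p.1.2.1
      simp only [Prod.mk.injEq] at hp
      constructor
      · intro h
        exact hx.2 ((hi x).symm.trans ((congrArg _ h).trans hp.1))
      · intro h
        exact hx.1 (hi.injective (h.trans hp.1.symm))⟩, fun x => p.1.1.2 x),
    fun x => Subtype.ext (p.1.2.1 x), fun x => p.1.2.2 x⟩
  invFun q := ⟨⟨(fun x => if h : x ≠ a ∧ x ≠ b then q.1.1 ⟨x, h⟩ else if x = a then b else a,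
      fun x => if h : x ≠ a ∧ x ≠ b then q.1.2 ⟨x, h⟩ else c), by
      constructor
      · intro x
        by_cases h : x ≠ a ∧ x ≠ b
        · have := (q.1.1 ⟨x, h⟩).2
          simp [h, this, q.2.1 _]
        · by_cases hx : x = a
          · subst hx; simp +contextual
          · have hb : x = b := by tauto
            subst hb; simp [hx]
      · intro x
        by_cases h : x ≠ a ∧ x ≠ b
        · have := (q.1.1 ⟨x, h⟩).2
          simp [h, this, q.2.2 _]
        · by_cases hx : x = a
          · subst hx; simp
          · have hb : x = b := by tauto
            subst hb; simp [hx]⟩, by simp⟩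
  left_inv p := by
    obtain ⟨⟨⟨s, d⟩, hs, hd⟩, hp⟩ := p
    simp only [Prod.mk.injEq] at hp hs hd
    obtain ⟨rfl, rfl⟩ := hp
    apply Subtype.ext
    apply Subtype.ext
    refine Prod.ext (funext fun x => ?_) (funext fun x => ?_)
    · by_cases hx : x = a
      · simp [hx]
      · by_cases hb : x = s a
        · simp [hb, hs a]
        · simp [hx, hb]
    · by_cases hx : x = a
      · simp [hx]
      · by_cases hb : x = s a
        · simp [hb, hd a]
        · simp [hx, hb]
  right_inv q := by
    apply Subtype.ext
    refine Prod.ext (funext fun x => Subtype.ext ?_) (funext fun x => ?_)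
    · simp [x.2]
    · simp [x.2]

theorem card_eq_sum {α : Type*} [Fintype α] [DecidableEq α] (a : α) :
    Nat.card (ColouredInvolution α) =
      ∑ b : α, 2 * Nat.card (ColouredInvolution {x : α // x ≠ a ∧ x ≠ b}) := by
  rw [Nat.card_congr (Equiv.sigmaFiberEquiv
    fun p : ColouredInvolution α => (p.1.1 a, p.1.2 a)).symm, Nat.card_sigma,
    Fintype.sum_prod_type]
  refine Finset.sum_congr rfl fun b _ => ?_
  simp only [Nat.card_congr (fiberEquiv a b _), Finset.sum_const, Finset.card_univ,
    Fintype.card_bool, smul_eq_mul]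

theorem card_eq_card_fin {α : Type*} [Fintype α] {m : ℕ} (h : Fintype.card α = m) :
    Nat.card (ColouredInvolution α) = Nat.card (ColouredInvolution (Fin m)) :=
  Nat.card_congr (congr (Fintype.equivFinOfCardEq h))

theorem card_fin_zero : Nat.card (ColouredInvolution (Fin 0)) = 1 := by
  have : Unique (ColouredInvolution (Fin 0)) :=
    { default := ⟨(id, fun _ => true), fun _ => rfl, fun _ => rfl⟩
      uniq := fun _ => Subsingleton.elim _ _ }
  exact Nat.card_unique

theorem card_fin_succ (m : ℕ) :
    Nat.card (ColouredInvolution (Fin (m + 1))) =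
      2 * Nat.card (ColouredInvolution (Fin m)) +
        2 * m * Nat.card (ColouredInvolution (Fin (m - 1))) := by
  rw [card_eq_sum (0 : Fin (m + 1)), Fin.sum_univ_succ]
  congr 1
  · congr 1
    exact card_eq_card_fin (by simp [Fintype.card_subtype_compl])
  · have h (i : Fin m) : Nat.card (ColouredInvolution {x : Fin (m + 1) // x ≠ 0 ∧ x ≠ i.succ}) =
        Nat.card (ColouredInvolution (Fin (m - 1))) := by
      refine card_eq_card_fin ?_
      have hs : (Finset.univ.filter fun x : Fin (m + 1) => x ≠ 0 ∧ x ≠ i.succ) =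
          ({0, i.succ} : Finset (Fin (m + 1)))ᶜ := by
        ext x; simp
      rw [Fintype.card_subtype, hs, Finset.card_compl, Fintype.card_fin,
        Finset.card_pair (Fin.succ_ne_zero i).symm]
      omega
    simp only [h, Finset.sum_const, Finset.card_univ, Fintype.card_fin, smul_eq_mul]
    ring

theorem card_fin_eq (g : ℕ → ℕ) (hg1 : g 1 = 2) (hg2 : g 2 = 6)
    (hgrec : ∀ n, 3 ≤ n → g n = 2 * g (n - 1) + (2 * n - 2) * g (n - 2)) (m : ℕ) (hm : 1 ≤ m) :
    Nat.card (ColouredInvolution (Fin m)) = g m := by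
  induction m using Nat.strong_induction_on with
  | _ m ih =>
    match m, hm with
    | 1, _ => rw [card_fin_succ, card_fin_zero, hg1]
    | 2, _ => rw [card_fin_succ, ih 1 (by omega) le_rfl, hg1, hg2, Nat.sub_self, card_fin_zero]
    | k + 3, _ =>
      rw [card_fin_succ, hgrec _ (by omega), ih (k + 2) (by omega) (by omega),
        ih (k + 2 - 1) (by omega) (by omega)]
      congr 2

end ColouredInvolution

/-- The identity of `ℂ` for `false` and complex conjugation for `true`. -/
noncomputable def boolConj (c : Bool) : ℂ →ₐ[ℝ] ℂ :=
  if c then Complex.conjAe.toAlgHom else AlgHom.id ℝ ℂ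

theorem boolConj_boolConj (c : Bool) (z : ℂ) : boolConj c (boolConj c z) = z := by
  cases c <;> simp [boolConj]

theorem boolConj_I_injective : Function.Injective fun c => boolConj c Complex.I := by
  intro c d h
  have hI : -Complex.I ≠ Complex.I := by simp [Complex.ext_iff]; norm_num
  cases c <;> cases d <;> simp_all [boolConj, eq_comm]

theorem eq_of_boolConj_boolConj_I {c d : Bool} (h : boolConj c (boolConj d Complex.I) = Complex.I) :
    d = c := by
  apply boolConj_I_injective
  simpa [boolConj_boolConj] using congrArg (boolConj c) h

/-- A real-algebra map `ℂ^ι → ℂ` is a coordinate projection, possibly followed by conjugation. -/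
theorem exists_eq_boolConj_apply {ι : Type*} [Fintype ι] (φ : (ι → ℂ) →ₐ[ℝ] ℂ) :
    ∃ j c, ∀ x, φ x = boolConj c (x j) := by
  classical
  obtain ⟨j, hj⟩ : ∃ j, φ (Pi.single j 1) ≠ 0 := by
    by_contra! h
    have h1 : φ (∑ j, Pi.single j 1) = 1 := by
      rw [show ∑ j, Pi.single j (1 : ℂ) = (1 : ι → ℂ) from Finset.univ_sum_single 1, map_one]
    rw [map_sum] at h1
    simp [h] at h1
  have hj1 : φ (Pi.single j 1) = 1 := by
    have h := map_mul φ (Pi.single j 1) (Pi.single j 1)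
    rw [← Pi.single_mul, one_mul] at h
    exact mul_left_cancel₀ hj (by rw [← h, mul_one])
  have hφ (x : ι → ℂ) : φ x = φ (Pi.single j (x j)) := by
    rw [← mul_one (φ x), ← hj1, ← map_mul]
    congr 1
    ext i
    by_cases h : i = j
    · subst h; simp
    · simp [h]
  let ψ : ℂ →ₐ[ℝ] ℂ := φ.comp (Pi.constAlgHom ℝ ι ℂ)
  have hψ (x : ι → ℂ) : φ x = ψ (x j) := by
    exact (hφ x).trans (hφ (Pi.constAlgHom ℝ ι ℂ (x j))).symm
  rcases Complex.real_algHom_eq_id_or_conj ψ with h | h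
  · exact ⟨j, false, fun x => by rw [hψ, h]; rfl⟩
  · exact ⟨j, true, fun x => by rw [hψ, h]; rfl⟩

/-- The endomorphism of `ℂ^ι` that permutes coordinates along `s` and conjugates the coordinates
marked by `c`. -/
noncomputable def twistedPullback {ι : Type*} (s : ι → ι) (c : ι → Bool) :
    (ι → ℂ) →ₐ[ℝ] (ι → ℂ) :=
  AlgHom.pi fun i => (boolConj (c i)).comp (Pi.evalAlgHom ℝ (fun _ => ℂ) (s i))

theorem twistedPullback_apply {ι : Type*} (s : ι → ι) (c : ι → Bool) (x : ι → ℂ) (i : ι) :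
    twistedPullback s c x i = boolConj (c i) (x (s i)) := rfl

theorem ColouredInvolution.twistedPullback_comp_self {ι : Type*} (p : ColouredInvolution ι) :
    (twistedPullback p.1.1 p.1.2).comp (twistedPullback p.1.1 p.1.2) = AlgHom.id ℝ (ι → ℂ) := by
  ext x i
  simp only [AlgHom.comp_apply, twistedPullback_apply, p.2.1 i, p.2.2 i, boolConj_boolConj,
    AlgHom.id_apply]

/-- The involution of `ℂ^ι` attached to a coloured involution of `ι`. -/
noncomputable def ColouredInvolution.toAlgEquiv {ι : Type*} (p : ColouredInvolution ι) :
    {f : (ι → ℂ) ≃ₐ[ℝ] (ι → ℂ) // (⇑f) ∘ (⇑f) = id} :=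
  ⟨AlgEquiv.ofAlgHom _ _ p.twistedPullback_comp_self p.twistedPullback_comp_self,
    funext fun x => DFunLike.congr_fun p.twistedPullback_comp_self x⟩

theorem ColouredInvolution.toAlgEquiv_apply {ι : Type*} (p : ColouredInvolution ι) (x : ι → ℂ)
    (i : ι) : p.toAlgEquiv.1 x i = boolConj (p.1.2 i) (x (p.1.1 i)) := rfl

theorem ColouredInvolution.toAlgEquiv_bijective {ι : Type*} [Fintype ι] :
    Function.Bijective (toAlgEquiv : ColouredInvolution ι → _) := by
  classical
  constructor
  · intro p q h
    have h' (x : ι → ℂ) (i : ι) :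
        boolConj (p.1.2 i) (x (p.1.1 i)) = boolConj (q.1.2 i) (x (q.1.1 i)) := by
      rw [← toAlgEquiv_apply, h, toAlgEquiv_apply]
    apply Subtype.ext
    refine Prod.ext (funext fun i => ?_) (funext fun i => ?_)
    · by_contra hne
      have := h' (Pi.single (p.1.1 i) 1) i
      simp [Ne.symm hne] at this
    · exact boolConj_I_injective (h' (fun _ => Complex.I) i)
  · rintro ⟨f, hf⟩
    choose s c h using fun i =>
      exists_eq_boolConj_apply ((Pi.evalAlgHom ℝ (fun _ : ι => ℂ) i).comp f.toAlgHom)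
    replace h (i : ι) (x : ι → ℂ) : f x i = boolConj (c i) (x (s i)) := h i x
    have hff (x : ι → ℂ) (i : ι) : boolConj (c i) (boolConj (c (s i)) (x (s (s i)))) = x i := by
      rw [← h, ← h]
      exact congrFun (congrFun hf x) i
    refine ⟨⟨(s, c), fun i => ?_, fun i => ?_⟩, ?_⟩
    · by_contra hne
      have := hff (Pi.single i 1) i
      simp [hne] at this
    · exact eq_of_boolConj_boolConj_I (hff (fun _ => Complex.I) i)
    · apply Subtype.ext
      ext x i
      rw [toAlgEquiv_apply, h]

/-- If `g(1) = 2`, `g(2) = 6` and `g(n) = 2 g(n-1) + (2n-2) g(n-2)` for `n ≥ 3`, then for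
each `n ≥ 1` the number of involutions of `MC(n)` (real-algebra automorphisms `f` of
`ℂ^(2^(n-1))` with `f ∘ f = id`) equals `g(2^(n-1))`. -/
theorem card_involutions_recursion (g : ℕ → ℕ) (hg1 : g 1 = 2) (hg2 : g 2 = 6)
    (hgrec : ∀ n, 3 ≤ n → g n = 2 * g (n - 1) + (2 * n - 2) * g (n - 2))
    (n : ℕ) (hn : 1 ≤ n) :
    Nat.card {f : (Fin (2 ^ (n - 1)) → ℂ) ≃ₐ[ℝ] (Fin (2 ^ (n - 1)) → ℂ) //
        (⇑f) ∘ (⇑f) = id} = g (2 ^ (n - 1)) := by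
  rw [← Nat.card_congr (Equiv.ofBijective _ ColouredInvolution.toAlgEquiv_bijective)]
  exact ColouredInvolution.card_fin_eq g hg1 hg2 hgrec _ Nat.one_le_two_pow
end

section
/- Let F(n) denote the number of involutions of MC(n), i.e. real-algebra automorphisms f of ℂ^(2^(n-1)) with f ∘ f = id. Then F(n) ∼ (2^n / e)^(2^(n-2)) · e^(2^(n/2)) / √(2e) as n → ∞; that is, the ratio F(n) / [ (2^n / e)^(2^(n-2)) · e^(2^(n/2)) / √(2e) ] tends to 1 as n → ∞ (here the exponents 2^(n-2) and 2^(n/2) are real powers). -/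
open Filter Real

/-- The numbers with exponential generating function `exp (2 x + x ^ 2)`. -/
def signedInvolutionNumber : ℕ → ℕ
  | 0 => 1
  | 1 => 2
  | n + 2 => 2 * signedInvolutionNumber (n + 1) + 2 * (n + 1) * signedInvolutionNumber n

/-- Involutions of `α` together with an invariant two-colouring. -/
def SignedInvolution (α : Type*) : Type _ :=
  {p : (α → α) × (α → Bool) // ∀ x, p.1 (p.1 x) = x ∧ p.2 (p.1 x) = p.2 x}

namespace SignedInvolution

instance (α : Type*) [Finite α] : Finite (SignedInvolution α) :=
  inferInstanceAs (Finite {_p : (α → α) × (α → Bool) // _})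

/-- A signed involution sending `a` to `b` is determined by the colour of `a` and by its
restriction to the complement of `{a, b}`. -/
def fiberEquiv {α : Type*} [DecidableEq α] (a b : α) :
    {p : SignedInvolution α // p.1.1 a = b} ≃
      SignedInvolution {x : α // x ≠ a ∧ x ≠ b} × Bool where
  toFun p := by
    refine (⟨(fun x => ⟨p.1.1.1 x, ?_, ?_⟩, fun x => p.1.1.2 x), ?_⟩, p.1.1.2 a)
    · intro h
      have := (p.1.2 x).1
      exact x.2.2 (by rw [← this, h, p.2])
    · intro h
      have h1 := (p.1.2 x).1
      have h2 := (p.1.2 a).1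
      rw [p.2] at h2
      exact x.2.1 (by rw [← h1, h, h2])
    · intro x
      exact ⟨Subtype.ext (p.1.2 x).1, (p.1.2 x).2⟩
  invFun q := ⟨⟨(fun x => if h : x ≠ a ∧ x ≠ b then (q.1.1.1 ⟨x, h⟩ : α)
        else if x = a then b else a,
      fun x => if h : x ≠ a ∧ x ≠ b then q.1.1.2 ⟨x, h⟩ else q.2), by
        intro x
        by_cases h : x ≠ a ∧ x ≠ b
        · have h3 := q.1.2 ⟨x, h⟩
          have h4 := (q.1.1.1 ⟨x, h⟩).2
          simp only [dif_pos h, dif_pos h4, Subtype.coe_eta]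
          exact ⟨congrArg Subtype.val h3.1, h3.2⟩
        · by_cases hx : x = a
          · subst hx
            simp
          · have hb : x = b := by tauto
            subst hb
            simp [hx]⟩, by simp⟩
  left_inv p := by
    obtain ⟨⟨⟨σ, s⟩, h⟩, hp⟩ := p
    simp only at hp h
    subst hp
    refine Subtype.ext (Subtype.ext (Prod.ext ?_ ?_))
    · funext x
      have := h x
      have := h a
      dsimp only
      split_ifs <;> grind
    · funext x
      have := h x
      have := h a
      dsimp only
      split_ifs <;> grind
  right_inv q := by
    obtain ⟨⟨⟨σ, s⟩, h⟩, c⟩ := q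
    refine Prod.ext (Subtype.ext (Prod.ext ?_ ?_)) ?_
    · funext x
      have := x.2
      simp [this]
    · funext x
      have := x.2
      simp [this]
    · simp

theorem card_eq (α : Type*) [Finite α] :
    Nat.card (SignedInvolution α) = signedInvolutionNumber (Nat.card α) := by
  classical
  induction hn : Nat.card α using Nat.strong_induction_on generalizing α with
  | _ n ih =>
  have := Fintype.ofFinite α
  rcases n with _ | n
  · have : IsEmpty α := (Nat.card_eq_zero.1 hn).resolve_right (fun h => h.not_finite ‹_›)
    have : Unique (SignedInvolution α) :=
      { default := ⟨(id, fun _ => true), fun x => isEmptyElim x⟩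
        uniq := fun p => Subtype.ext (Subsingleton.elim _ _) }
    simp [signedInvolutionNumber]
  · have : Nonempty α := (Nat.card_pos_iff.1 (hn ▸ n.succ_pos)).1
    obtain ⟨a⟩ := this
    have hcard : ∀ b : α, Nat.card {x : α // x ≠ a ∧ x ≠ b} = n + 1 - ({a, b} : Finset α).card := by
      intro b
      rw [← hn, Nat.card_eq_fintype_card, Fintype.card_subtype, Nat.card_eq_fintype_card,
        ← Finset.card_compl]
      congr 1
      ext x
      simp
    have h1 : ∀ b : α, Nat.card {p : SignedInvolution α // p.1.1 a = b} =
        2 * (if b = a then signedInvolutionNumber n else signedInvolutionNumber (n - 1)) := by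
      intro b
      rw [Nat.card_congr (fiberEquiv a b), Nat.card_prod]
      have hb := hcard b
      split_ifs with h
      · subst h
        rw [ih n (by omega) _ (by simpa using hb)]
        simp [mul_comm]
      · rw [Finset.card_pair (Ne.symm h)] at hb
        rw [ih (n - 1) (by omega) _ (by rw [hb]; omega)]
        simp [mul_comm]
    rw [← Nat.card_congr (Equiv.sigmaFiberEquiv fun p : SignedInvolution α => p.1.1 a),
      Nat.card_sigma, Finset.sum_congr rfl fun b _ => h1 b, ← Finset.mul_sum,
      ← Finset.add_sum_erase _ _ (Finset.mem_univ a), if_pos rfl,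
      Finset.sum_congr rfl fun b hb => if_neg (Finset.ne_of_mem_erase hb), Finset.sum_const,
      Finset.card_erase_of_mem (Finset.mem_univ a), Finset.card_univ,
      ← Nat.card_eq_fintype_card, hn]
    rcases n with _ | n
    · simp [signedInvolutionNumber]
    · simp [signedInvolutionNumber]
      ring

end SignedInvolution

/-- The identity or complex conjugation, as a real-algebra homomorphism. -/
noncomputable def idOrConj (b : Bool) : ℂ →ₐ[ℝ] ℂ := if b then AlgHom.id ℝ ℂ else Complex.conjAe

theorem idOrConj_idOrConj (b : Bool) (z : ℂ) : idOrConj b (idOrConj b z) = z := by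
  cases b <;> simp [idOrConj]

theorem idOrConj_injective : Function.Injective idOrConj := by
  intro b c h
  have := congrArg Complex.im (DFunLike.congr_fun h Complex.I)
  cases b <;> cases c <;> simp [idOrConj] at this ⊢ <;> norm_num at this

theorem idOrConj_eq_zero {b : Bool} {z : ℂ} : idOrConj b z = 0 ↔ z = 0 := by
  cases b <;> simp [idOrConj]

section ProductAlgebra

variable {ι : Type*}

/-- If two twisted evaluations on `ι → ℂ` agree, so do their points and twists. -/
theorem eq_and_eq_of_idOrConj_apply [DecidableEq ι] {i j : ι} {b c : Bool}
    (h : ∀ x : ι → ℂ, idOrConj b (x i) = idOrConj c (x j)) : i = j ∧ b = c := by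
  constructor
  · by_contra hij
    have := h (Pi.single i 1)
    rw [Pi.single_eq_same, Pi.single_eq_of_ne (Ne.symm hij), map_zero, idOrConj_eq_zero] at this
    exact one_ne_zero this
  · exact idOrConj_injective (AlgHom.ext fun z => h fun _ => z)

theorem exists_eq_idOrConj_apply [Finite ι] (φ : (ι → ℂ) →ₐ[ℝ] ℂ) :
    ∃ (i : ι) (b : Bool), ∀ x, φ x = idOrConj b (x i) := by
  classical
  have := Fintype.ofFinite ι
  obtain ⟨i, hi⟩ : ∃ i, φ (Pi.single i 1) ≠ 0 := by
    by_contra! h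
    have h1 : φ (∑ i, Pi.single i 1) = 0 := by rw [map_sum]; exact Finset.sum_eq_zero fun i _ => h i
    rw [show (∑ i : ι, Pi.single i (1 : ℂ)) = 1 from Finset.univ_sum_single (1 : ι → ℂ),
      map_one] at h1
    exact one_ne_zero h1
  have key : ∀ x, φ x = φ (fun _ => x i) := by
    intro x
    refine mul_right_cancel₀ hi ?_
    rw [← map_mul, ← map_mul]
    congr 1
    ext j
    by_cases hj : j = i
    · subst hj; simp
    · simp [hj]
  rcases Complex.real_algHom_eq_id_or_conj (φ.comp (Pi.constAlgHom ℝ ι ℂ)) with h | h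
  · exact ⟨i, true, fun x => (key x).trans (DFunLike.congr_fun h (x i))⟩
  · exact ⟨i, false, fun x => (key x).trans (DFunLike.congr_fun h (x i))⟩

/-- The real-algebra endomorphism permuting and conjugating coordinates. -/
noncomputable def twistedPermHom (σ : ι → ι) (s : ι → Bool) : (ι → ℂ) →ₐ[ℝ] (ι → ℂ) :=
  AlgHom.pi fun i => (idOrConj (s i)).comp (Pi.evalAlgHom ℝ _ (σ i))

theorem twistedPermHom_apply (σ : ι → ι) (s : ι → Bool) (x : ι → ℂ) (i : ι) :
    twistedPermHom σ s x i = idOrConj (s i) (x (σ i)) := rfl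

theorem SignedInvolution.twistedPermHom_comp_self (p : SignedInvolution ι) :
    (twistedPermHom p.1.1 p.1.2).comp (twistedPermHom p.1.1 p.1.2) = AlgHom.id ℝ _ := by
  ext x i
  simp [twistedPermHom_apply, (p.2 i).1, (p.2 i).2, idOrConj_idOrConj]

/-- The involution of `ι → ℂ` attached to a signed involution of `ι`. -/
noncomputable def SignedInvolution.toInvolution (p : SignedInvolution ι) :
    {f : (ι → ℂ) ≃ₐ[ℝ] (ι → ℂ) // (⇑f) ∘ (⇑f) = id} :=
  ⟨AlgEquiv.ofAlgHom _ _ p.twistedPermHom_comp_self p.twistedPermHom_comp_self,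
    funext fun x => DFunLike.congr_fun p.twistedPermHom_comp_self x⟩

theorem SignedInvolution.toInvolution_apply (p : SignedInvolution ι) (x : ι → ℂ) (i : ι) :
    p.toInvolution.1 x i = idOrConj (p.1.2 i) (x (p.1.1 i)) := rfl

theorem SignedInvolution.toInvolution_bijective [Finite ι] :
    Function.Bijective (SignedInvolution.toInvolution (ι := ι)) := by
  classical
  constructor
  · intro p q h
    have key (i : ι) := eq_and_eq_of_idOrConj_apply (i := p.1.1 i) (j := q.1.1 i)
      (b := p.1.2 i) (c := q.1.2 i) fun x => by
        rw [← toInvolution_apply, ← toInvolution_apply, h]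
    exact Subtype.ext (Prod.ext (funext fun i => (key i).1) (funext fun i => (key i).2))
  · rintro ⟨f, hf⟩
    choose σ s h using fun i =>
      exists_eq_idOrConj_apply ((Pi.evalAlgHom ℝ (fun _ : ι => ℂ) i).comp
        (f : (ι → ℂ) →ₐ[ℝ] (ι → ℂ)))
    replace h : ∀ i x, f x i = idOrConj (s i) (x (σ i)) := h
    refine ⟨⟨(σ, s), fun i => ?_⟩, Subtype.ext (AlgEquiv.ext fun x => funext fun i => (h i x).symm)⟩
    refine eq_and_eq_of_idOrConj_apply fun x => ?_
    rw [← idOrConj_idOrConj (s i) (idOrConj (s (σ i)) _), ← h, ← h]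
    exact congrArg _ (congrFun (congrFun hf x) i)

end ProductAlgebra

theorem card_involution_pi_complex (ι : Type*) [Finite ι] :
    Nat.card {f : (ι → ℂ) ≃ₐ[ℝ] (ι → ℂ) // (⇑f) ∘ (⇑f) = id} =
      signedInvolutionNumber (Nat.card ι) := by
  rw [← SignedInvolution.card_eq,
    Nat.card_congr (Equiv.ofBijective _ SignedInvolution.toInvolution_bijective)]

open MeasureTheory Topology

theorem exp_neg_mul_sq_add_mul_eq {b : ℝ} (hb : b ≠ 0) (c y : ℝ) :
    exp (-b * y ^ 2 + c * y) = exp (c ^ 2 / (4 * b)) * exp (-b * (y - c / (2 * b)) ^ 2) := by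
  rw [← exp_add]
  congr 1
  field_simp
  ring

theorem integrable_exp_neg_mul_sq_add_mul {b : ℝ} (hb : 0 < b) (c : ℝ) :
    Integrable fun y : ℝ => exp (-b * y ^ 2 + c * y) := by
  simp_rw [exp_neg_mul_sq_add_mul_eq hb.ne']
  exact ((integrable_exp_neg_mul_sq hb).comp_sub_right _).const_mul _

theorem integral_exp_neg_mul_sq_add_mul {b : ℝ} (hb : 0 < b) (c : ℝ) :
    ∫ y : ℝ, exp (-b * y ^ 2 + c * y) = exp (c ^ 2 / (4 * b)) * √(π / b) := by
  simp_rw [exp_neg_mul_sq_add_mul_eq hb.ne']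
  rw [integral_const_mul, integral_sub_right_eq_self fun y : ℝ => exp (-b * y ^ 2),
    integral_gaussian]

theorem integrable_pow_mul_exp_neg_mul_sq_add_mul {b : ℝ} (hb : 0 < b) (c : ℝ) (N : ℕ) :
    Integrable fun y : ℝ => y ^ N * exp (-b * y ^ 2 + c * y) := by
  refine Integrable.mono' (((integrable_exp_neg_mul_sq_add_mul hb (c + 1)).add
    (integrable_exp_neg_mul_sq_add_mul hb (c - 1))).const_mul (N.factorial : ℝ))
    (by fun_prop) (ae_of_all _ fun y => ?_)
  have h1 : |y| ^ N ≤ N.factorial * exp |y| := by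
    have := pow_div_factorial_le_exp _ (abs_nonneg y) N
    rwa [div_le_iff₀' (by positivity)] at this
  have h2 : exp |y| ≤ exp y + exp (-y) := by
    rcases abs_cases y with h | h <;> rw [h.1] <;> linarith [exp_pos y, exp_pos (-y)]
  have h3 : exp (-b * y ^ 2 + (c + 1) * y) = exp y * exp (-b * y ^ 2 + c * y) := by
    rw [← exp_add]; congr 1; ring
  have h4 : exp (-b * y ^ 2 + (c - 1) * y) = exp (-y) * exp (-b * y ^ 2 + c * y) := by
    rw [← exp_add]; congr 1; ring
  simp only [Pi.add_apply]
  rw [norm_mul, norm_pow, norm_eq_abs, norm_eq_abs, abs_exp, h3, h4, ← add_mul, ← mul_assoc]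
  gcongr
  exact h1.trans (by gcongr)

/-- The moment integral with weight `exp (-y ^ 2 / 4 + y)`. -/
noncomputable def gaussianMoment (N : ℕ) : ℝ :=
  ∫ y : ℝ, y ^ N * exp (-(1 / 4) * y ^ 2 + 1 * y)

theorem integrable_gaussianMoment (N : ℕ) :
    Integrable fun y : ℝ => y ^ N * exp (-(1 / 4) * y ^ 2 + 1 * y) :=
  integrable_pow_mul_exp_neg_mul_sq_add_mul (by norm_num) 1 N

theorem gaussianMoment_zero : gaussianMoment 0 = 2 * √π * exp 1 := by
  have h : √(π / (1 / 4)) = 2 * √π := by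
    rw [show π / (1 / 4) = 2 ^ 2 * π by ring, sqrt_mul (by positivity), sqrt_sq (by norm_num)]
  simp only [gaussianMoment, pow_zero, one_mul (exp _)]
  rw [integral_exp_neg_mul_sq_add_mul (by norm_num), h]
  norm_num
  ring

theorem hasDerivAt_exp_neg_sq_div_four_add (y : ℝ) :
    HasDerivAt (fun y : ℝ => exp (-(1 / 4) * y ^ 2 + 1 * y))
      (exp (-(1 / 4) * y ^ 2 + 1 * y) * (1 - y / 2)) y := by
  have : HasDerivAt (fun y : ℝ => -(1 / 4) * y ^ 2 + 1 * y) (1 - y / 2) y := by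
    refine (((hasDerivAt_pow 2 y).const_mul (-(1 / 4) : ℝ)).add
      ((hasDerivAt_id y).const_mul (1 : ℝ))).congr_deriv ?_
    norm_num
    ring
  exact this.exp

theorem gaussianMoment_one : gaussianMoment 1 = 2 * gaussianMoment 0 := by
  have i0 := integrable_gaussianMoment 0
  have i1 := integrable_gaussianMoment 1
  have hd : ∀ y : ℝ, HasDerivAt (fun y : ℝ => y ^ 0 * exp (-(1 / 4) * y ^ 2 + 1 * y))
      (y ^ 0 * exp (-(1 / 4) * y ^ 2 + 1 * y) -
        2⁻¹ * (y ^ 1 * exp (-(1 / 4) * y ^ 2 + 1 * y))) y := by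
    intro y
    simp only [pow_zero, one_mul (exp _)]
    refine (hasDerivAt_exp_neg_sq_div_four_add y).congr_deriv ?_
    ring
  have := integral_eq_zero_of_hasDerivAt_of_integrable hd (i0.sub (i1.const_mul _)) i0
  rw [integral_sub i0 (i1.const_mul _), integral_const_mul] at this
  unfold gaussianMoment
  linarith

theorem gaussianMoment_add_two (N : ℕ) :
    gaussianMoment (N + 2) = 2 * gaussianMoment (N + 1) + 2 * (N + 1) * gaussianMoment N := by
  have i0 := (integrable_gaussianMoment N).const_mul (N + 1 : ℝ)
  have i1 := integrable_gaussianMoment (N + 1)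
  have i2 := (integrable_gaussianMoment (N + 2)).const_mul (2⁻¹ : ℝ)
  have i01 : Integrable fun y : ℝ => (N + 1 : ℝ) * (y ^ N * exp (-(1 / 4) * y ^ 2 + 1 * y)) +
      y ^ (N + 1) * exp (-(1 / 4) * y ^ 2 + 1 * y) := i0.add i1
  have hd : ∀ y : ℝ, HasDerivAt (fun y : ℝ => y ^ (N + 1) * exp (-(1 / 4) * y ^ 2 + 1 * y))
      ((N + 1 : ℝ) * (y ^ N * exp (-(1 / 4) * y ^ 2 + 1 * y)) +
        y ^ (N + 1) * exp (-(1 / 4) * y ^ 2 + 1 * y) -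
        2⁻¹ * (y ^ (N + 2) * exp (-(1 / 4) * y ^ 2 + 1 * y))) y := by
    intro y
    refine ((hasDerivAt_pow (N + 1) y).mul
      (hasDerivAt_exp_neg_sq_div_four_add y)).congr_deriv ?_
    simp only [Nat.add_sub_cancel, Nat.cast_add, Nat.cast_one]
    ring
  have := integral_eq_zero_of_hasDerivAt_of_integrable hd (i01.sub i2) i1
  rw [integral_sub i01 i2, integral_add i0 i1, integral_const_mul,
    integral_const_mul] at this
  unfold gaussianMoment
  linarith

theorem gaussianMoment_eq (N : ℕ) :
    gaussianMoment N = signedInvolutionNumber N * gaussianMoment 0 := by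
  induction N using Nat.twoStepInduction with
  | zero => simp [signedInvolutionNumber]
  | one => simp [signedInvolutionNumber, gaussianMoment_one]
  | more N h0 h1 =>
    rw [gaussianMoment_add_two, h0, h1, signedInvolutionNumber]
    push_cast
    ring

/-- The integrand of `gaussianMoment N`, recentred at `√(2 N)` and normalised. -/
noncomputable def recentredIntegrand (N : ℕ) (t : ℝ) : ℝ :=
  (1 + t / √(2 * N)) ^ N * exp (-(t * √(2 * N) / 2)) * exp (-(1 / 4) * t ^ 2 + 1 * t)

theorem gaussianMoment_eq_integral_recentredIntegrand {N : ℕ} (hN : 0 < N) :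
    gaussianMoment N =
      (2 * N / exp 1) ^ ((N : ℝ) / 2) * exp √(2 * N) * ∫ t, recentredIntegrand N t := by
  have hN' : (0 : ℝ) < 2 * N := by positivity
  set m := √(2 * N : ℝ) with hm
  have hm0 : 0 < m := sqrt_pos.2 hN'
  have hm2 : m ^ 2 = 2 * N := sq_sqrt hN'.le
  have hpow : (2 * N / exp 1 : ℝ) ^ ((N : ℝ) / 2) = m ^ N * exp (-(N / 2)) := by
    rw [div_rpow hN'.le (exp_pos 1).le, ← exp_mul, one_mul, div_eq_mul_inv, ← exp_neg, ← hm2,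
      ← rpow_natCast m 2, ← rpow_mul hm0.le, ← rpow_natCast m N]
    congr 2
    push_cast
    ring
  rw [gaussianMoment, ← integral_add_right_eq_self _ m, ← integral_const_mul]
  congr 1
  funext t
  rw [recentredIntegrand, ← hm, hpow]
  have h1 : (t + m) ^ N = m ^ N * (1 + t / m) ^ N := by
    rw [← mul_pow]
    congr 1
    field_simp
    ring
  have h2 : exp (-(1 / 4) * (t + m) ^ 2 + 1 * (t + m)) =
      exp (-(N / 2)) * exp m * exp (-(t * m / 2)) * exp (-(1 / 4) * t ^ 2 + 1 * t) := by
    rw [← exp_add, ← exp_add, ← exp_add]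
    congr 1
    linear_combination (-1 / 4 : ℝ) * hm2
  rw [h1, h2]
  ring

theorem norm_recentredIntegrand_le {N : ℕ} (hN : 0 < N) (t : ℝ) :
    ‖recentredIntegrand N t‖ ≤ exp (-(1 / 4) * t ^ 2 + 1 * t) + 2 * (1 + t ^ 2)⁻¹ := by
  have hN' : (0 : ℝ) < 2 * N := by positivity
  rw [recentredIntegrand]
  set m := √(2 * N : ℝ) with hm
  have hm0 : 0 < m := sqrt_pos.2 hN'
  have hm2 : m ^ 2 = 2 * N := sq_sqrt hN'.le
  obtain ⟨u, hu⟩ : ∃ u, u = t / m := ⟨_, rfl⟩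
  have htu : t = u * m := by rw [hu]; field_simp
  have h1 : t * m / 2 = N * u := by rw [htu]; linear_combination u / 2 * hm2
  have h2 : t ^ 2 = 2 * N * u ^ 2 := by rw [htu]; linear_combination u ^ 2 * hm2
  rw [norm_mul, norm_mul, norm_pow, norm_eq_abs, norm_eq_abs, norm_eq_abs, abs_exp, abs_exp, ← hu,
    h1]
  have h3 : (0 : ℝ) ≤ 2 * (1 + t ^ 2)⁻¹ := by positivity
  rcases le_total (-1) u with hle | hle
  · have h4 : |1 + u| ≤ exp u := by
      rw [abs_of_nonneg (by linarith)]
      linarith [add_one_le_exp u]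
    have h5 : |1 + u| ^ N * exp (-(N * u)) ≤ 1 := by
      calc |1 + u| ^ N * exp (-(N * u)) ≤ exp u ^ N * exp (-(N * u)) := by gcongr
        _ = 1 := by rw [← exp_nat_mul, ← exp_add]; simp
    have := mul_le_mul_of_nonneg_right h5 (exp_pos (-(1 / 4) * t ^ 2 + 1 * t)).le
    linarith
  · have h4 : |1 + u| ≤ exp (-u - 2) := by
      rw [abs_of_nonpos (by linarith)]
      linarith [add_one_le_exp (-u - 2)]
    have ht : t ≤ 0 := by rw [htu]; nlinarith
    have h5 : |1 + u| ^ N * exp (-(N * u)) * exp (-(1 / 4) * t ^ 2 + 1 * t) ≤ exp t := by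
      calc _ ≤ exp (-u - 2) ^ N * exp (-(N * u)) * exp (-(1 / 4) * t ^ 2 + 1 * t) := by gcongr
        _ = exp (-(N * (u + 2) ^ 2 / 2) + t) := by
          rw [← exp_nat_mul, ← exp_add, ← exp_add, h2]
          congr 1
          ring
        _ ≤ exp t := by
          apply exp_le_exp.2
          have : 0 ≤ N * (u + 2) ^ 2 / 2 := by positivity
          linarith
    have h6 : exp t ≤ 2 * (1 + t ^ 2)⁻¹ := by
      have h7 := quadratic_le_exp_of_nonneg (neg_nonneg.2 ht)
      rw [← div_eq_mul_inv, le_div_iff₀ (by positivity), ← le_div_iff₀' (exp_pos t),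
        div_eq_mul_inv, ← exp_neg]
      nlinarith
    linarith [exp_pos (-(1 / 4) * t ^ 2 + 1 * t)]

theorem tendsto_sqrt_two_mul_natCast : Tendsto (fun N : ℕ => √(2 * N : ℝ)) atTop atTop :=
  tendsto_sqrt_atTop.comp (tendsto_natCast_atTop_atTop.const_mul_atTop two_pos)

theorem tendsto_recentredIntegrand (t : ℝ) :
    Tendsto (fun N => recentredIntegrand N t) atTop (𝓝 (exp (-(1 / 2) * t ^ 2 + 1 * t))) := by
  have hu : Tendsto (fun N : ℕ => t / √(2 * N : ℝ)) atTop (𝓝 0) :=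
    tendsto_sqrt_two_mul_natCast.const_div_atTop t
  have hrem : Tendsto (fun N : ℕ => (N : ℝ) * (log (1 + t / √(2 * N)) - t / √(2 * N) +
      (t / √(2 * N)) ^ 2 / 2)) atTop (𝓝 0) := by
    have hb : Tendsto (fun N : ℕ => t ^ 2 / 2 * (|t / √(2 * N)| / (1 - |t / √(2 * N)|)))
        atTop (𝓝 0) := by
      have := (hu.abs.div (hu.abs.const_sub 1) (by simp)).const_mul (t ^ 2 / 2)
      simpa using this
    refine squeeze_zero_norm' ?_ hb
    filter_upwards [eventually_gt_atTop 0, hu.abs.eventually_lt_const (by simp : |(0 : ℝ)| < 1)]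
      with N hN h
    have hN' : (0 : ℝ) < 2 * N := by positivity
    have hm0 : 0 < √(2 * N : ℝ) := sqrt_pos.2 hN'
    have hm2 : √(2 * N : ℝ) ^ 2 = 2 * N := sq_sqrt hN'.le
    have htu : t ^ 2 / 2 = N * |t / √(2 * N : ℝ)| ^ 2 := by
      rw [sq_abs, div_pow, hm2]
      field_simp
    generalize t / √(2 * N : ℝ) = u at *
    have key := abs_log_sub_add_sum_range_le (x := -u) (by rwa [abs_neg]) 2
    rw [abs_neg, sub_neg_eq_add] at key
    simp only [Finset.sum_range_succ, Finset.sum_range_zero] at key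
    rw [norm_mul, norm_eq_abs, norm_eq_abs, Nat.abs_cast, htu]
    calc (N : ℝ) * |log (1 + u) - u + u ^ 2 / 2| ≤ N * (|u| ^ (2 + 1) / (1 - |u|)) := by
          gcongr
          refine le_of_eq_of_le (congrArg abs ?_) key
          push_cast
          ring
      _ = _ := by ring
  have hmain : Tendsto (fun N : ℕ => exp ((N : ℝ) * (log (1 + t / √(2 * N)) - t / √(2 * N) +
      (t / √(2 * N)) ^ 2 / 2)) * exp (-(1 / 2) * t ^ 2 + 1 * t)) atTop
      (𝓝 (exp (-(1 / 2) * t ^ 2 + 1 * t))) := by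
    simpa only [exp_zero, one_mul (exp _)] using
      hrem.rexp.mul_const (exp (-(1 / 2) * t ^ 2 + 1 * t))
  refine hmain.congr' ?_
  filter_upwards [eventually_gt_atTop 0, hu.abs.eventually_lt_const (by simp : |(0 : ℝ)| < 1)]
    with N hN h
  have hN' : (0 : ℝ) < 2 * N := by positivity
  rw [recentredIntegrand]
  set m := √(2 * N : ℝ) with hm
  have hm0 : 0 < m := sqrt_pos.2 hN'
  have hm2 : m ^ 2 = 2 * N := sq_sqrt hN'.le
  obtain ⟨u, hu⟩ : ∃ u, u = t / m := ⟨_, rfl⟩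
  have htu : t = u * m := by rw [hu]; field_simp
  have h1 : t * m / 2 = N * u := by rw [htu]; linear_combination u / 2 * hm2
  have h2 : t ^ 2 = 2 * N * u ^ 2 := by rw [htu]; linear_combination u ^ 2 * hm2
  rw [← hu] at h ⊢
  have hpos : 0 < 1 + u := by linarith [(abs_lt.1 h).1]
  rw [h1, ← exp_log (pow_pos hpos N), log_pow, ← exp_add, ← exp_add, ← exp_add, h2]
  congr 1
  ring

theorem tendsto_integral_recentredIntegrand :
    Tendsto (fun N => ∫ t, recentredIntegrand N t) atTop (𝓝 (exp (1 / 2) * √(2 * π))) := by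
  have h : ∫ t : ℝ, exp (-(1 / 2) * t ^ 2 + 1 * t) = exp (1 / 2) * √(2 * π) := by
    rw [integral_exp_neg_mul_sq_add_mul (by norm_num)]
    congr 2 <;> ring
  rw [← h]
  refine tendsto_integral_filter_of_dominated_convergence _
    (Eventually.of_forall fun N => ?_)
    ((eventually_gt_atTop 0).mono fun N hN => ae_of_all _ (norm_recentredIntegrand_le hN))
    ((integrable_exp_neg_mul_sq_add_mul (by norm_num) 1).add
      (integrable_inv_one_add_sq.const_mul 2))
    (ae_of_all _ tendsto_recentredIntegrand)
  unfold recentredIntegrand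
  fun_prop

theorem signedInvolutionNumber_asymptotics :
    Tendsto (fun N : ℕ => (signedInvolutionNumber N : ℝ) /
      ((2 * N / exp 1) ^ ((N : ℝ) / 2) * exp √(2 * N) / √(2 * exp 1))) atTop (𝓝 1) := by
  have hsq : exp (1 / 2) ^ 2 = exp 1 := by rw [← exp_nat_mul]; norm_num
  have hse : √(exp 1) = exp (1 / 2) := by rw [← hsq, sqrt_sq (exp_pos _).le]
  have hlim := tendsto_integral_recentredIntegrand.const_mul
    (√(2 * exp 1) / gaussianMoment 0)
  have hone : √(2 * exp 1) / gaussianMoment 0 * (exp (1 / 2) * √(2 * π)) = 1 := by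
    rw [gaussianMoment_zero, sqrt_mul two_pos.le, sqrt_mul two_pos.le, hse, ← hsq]
    have : √2 ^ 2 = (2 : ℝ) := sq_sqrt two_pos.le
    have : 0 < √π := sqrt_pos.2 pi_pos
    field_simp
    assumption
  rw [hone] at hlim
  refine hlim.congr' ?_
  filter_upwards [eventually_gt_atTop 0] with N hN
  have h0 : gaussianMoment 0 ≠ 0 := by
    rw [gaussianMoment_zero]
    have : 0 < √π := sqrt_pos.2 pi_pos
    positivity
  have hN' : (0 : ℝ) < N := by positivity
  have h := gaussianMoment_eq N
  rw [gaussianMoment_eq_integral_recentredIntegrand hN] at h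
  rw [eq_div_iff (by positivity)]
  field_simp
  linear_combination h

theorem two_pow_pred_identities {n : ℕ} (hn : 1 ≤ n) : (2 : ℝ) * (2 ^ (n - 1) : ℕ) = 2 ^ n ∧
    ((2 ^ (n - 1) : ℕ) : ℝ) / 2 = (2 : ℝ) ^ ((n : ℝ) - 2) ∧
    √((2 : ℝ) ^ n) = (2 : ℝ) ^ ((n : ℝ) / 2) := by
  obtain ⟨k, rfl⟩ := Nat.exists_eq_add_of_le' hn
  refine ⟨?_, ?_, ?_⟩
  · push_cast
    rw [pow_succ']
  · rw [show ((k + 1 : ℕ) : ℝ) - 2 = (k : ℝ) - 1 by push_cast; ring, rpow_sub_one two_ne_zero,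
      rpow_natCast]
    simp
  · rw [sqrt_eq_rpow, ← rpow_natCast, ← rpow_mul two_pos.le, mul_one_div]

/-- Writing `F(n)` for the number of involutions of `MC(n)` (real-algebra automorphisms `f`
of `ℂ^(2^(n-1))` with `f ∘ f = id`), we have
`F(n) ∼ (2^n/e)^(2^(n-2)) · e^(2^(n/2)) / √(2e)` as `n → ∞`, the exponents `2^(n-2)` and
`2^(n/2)` being real powers. -/
theorem card_involutions_asymptotics :
    Filter.Tendsto
      (fun n : ℕ =>
        (Nat.card {f : (Fin (2 ^ (n - 1)) → ℂ) ≃ₐ[ℝ] (Fin (2 ^ (n - 1)) → ℂ) //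
            (⇑f) ∘ (⇑f) = id} : ℝ) /
          (((2 : ℝ) ^ (n : ℕ) / Real.exp 1) ^ ((2 : ℝ) ^ ((n : ℝ) - 2)) *
              Real.exp ((2 : ℝ) ^ ((n : ℝ) / 2)) / Real.sqrt (2 * Real.exp 1)))
      Filter.atTop (nhds 1) := by
  have hN : Tendsto (fun n : ℕ => 2 ^ (n - 1)) atTop atTop :=
    (tendsto_pow_atTop_atTop_of_one_lt one_lt_two).comp (tendsto_sub_atTop_nat 1)
  refine (signedInvolutionNumber_asymptotics.comp hN).congr' ?_
  filter_upwards [eventually_ge_atTop 1] with n hn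
  obtain ⟨h1, h2, h3⟩ := two_pow_pred_identities hn
  rw [Function.comp_apply, h1, h2, h3, card_involution_pi_complex, Nat.card_fin]
end

section
/- Fix an integer m ≥ 1 and let f : ℂ^m → ℂ^m be a bijection satisfying f(0) = 0 and f(x * y) = f(x) * f(y) for all x, y. Then: (i) if x * x = x then f(x) * f(x) = f(x); (ii) for every x with x * x = x, the sets {ζ : ℂ^m | ζ * ζ = ζ ∧ x * ζ = 0} and {ζ : ℂ^m | ζ * ζ = ζ ∧ f(x) * ζ = 0} have the same cardinality; (iii) for every index j there exists an index k such that f(e_j) = e_k, where e_j denotes the standard basis idempotent whose j-th coordinate is 1 and whose other coordinates are 0. -/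
/-- Let `f` be a multiplicative bijection of `ℂ^m` with `f 0 = 0`. Then `f` maps
idempotents to idempotents, preserves the cardinality of the set of idempotents orthogonal
to a given idempotent, and maps each primitive idempotent `e_j = Pi.single j 1` to a
primitive idempotent. -/
theorem multiplicative_bijection_idempotents (m : ℕ) (hm : 1 ≤ m)
    (f : (Fin m → ℂ) → (Fin m → ℂ)) (hbij : Function.Bijective f) (h0 : f 0 = 0)
    (hmul : ∀ x y, f (x * y) = f x * f y) :
    (∀ x : Fin m → ℂ, x * x = x → f x * f x = f x) ∧
    (∀ x : Fin m → ℂ, x * x = x →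
      Nat.card {ζ : Fin m → ℂ | ζ * ζ = ζ ∧ f x * ζ = 0} =
        Nat.card {ζ : Fin m → ℂ | ζ * ζ = ζ ∧ x * ζ = 0}) ∧
    (∀ j : Fin m, ∃ k : Fin m, f (Pi.single j 1) = Pi.single k 1) := by
  have idem_iff : ∀ x, f x * f x = f x ↔ x * x = x := fun x => by
    rw [← hmul, hbij.injective.eq_iff]
  have orth_iff : ∀ x y, f x * f y = 0 ↔ x * y = 0 := fun x y => by
    rw [← hmul, ← h0, hbij.injective.eq_iff, h0]
  refine ⟨fun x hx => (idem_iff x).2 hx, fun x _ => ?_, fun j => ?_⟩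
  · refine (Nat.card_congr ((Equiv.ofBijective f hbij).subtypeEquiv fun ζ => ?_)).symm
    simp [idem_iff, orth_iff]
  · have e_ne : f (Pi.single j 1) ≠ 0 := by
      rw [← h0, hbij.injective.ne_iff]
      simp
    have e_idem : f (Pi.single j 1) * f (Pi.single j 1) = f (Pi.single j 1) := by
      rw [idem_iff, ← Pi.single_mul, one_mul]
    obtain ⟨k, hk⟩ := Function.ne_iff.1 e_ne
    have hk_one : f (Pi.single j 1) k = 1 := mul_left_cancel₀ hk (by simpa using congrFun e_idem k)
    obtain ⟨y, hy⟩ := hbij.surjective (Pi.single k 1)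
    have y_idem : y * y = y := by
      rw [← idem_iff, hy, ← Pi.single_mul, one_mul]
    have y_ne : y ≠ 0 := by
      rintro rfl
      simpa [h0] using congrFun hy k
    have y_le : Pi.single j 1 * y = y := by
      apply hbij.injective
      rw [hmul, hy, ← Pi.single_mul_right, hk_one, one_mul]
    have y_eq : Pi.single j (y j) = y := by
      rwa [← Pi.single_mul_left, one_mul] at y_le
    have hyj : y j ≠ 0 := fun h => y_ne (by rw [← y_eq, h, Pi.single_zero])
    have hyj_one : y j = 1 := mul_left_cancel₀ hyj (by simpa using congrFun y_idem j)
    exact ⟨k, by rw [← hy, ← y_eq, hyj_one]⟩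
end

section
/- Fix an integer m ≥ 1 and let f be a real-algebra automorphism of ℂ^m with f ∘ f = id. Let 𝕚 denote the element of ℂ^m all of whose coordinates equal the imaginary unit i. If h : ℂ^m satisfies h * h = 1 and f(𝕚) = 𝕚 * h, then f(h) = h. -/
/-- Let `f` be an involution of `ℂ^m` (a real-algebra automorphism with `f ∘ f = id`) and
let `𝕚` be the constant function with value `i`. If `h * h = 1` and `f 𝕚 = 𝕚 * h`, then
`f h = h`. -/
theorem involution_fixes_h (m : ℕ) (hm : 1 ≤ m)
    (f : (Fin m → ℂ) ≃ₐ[ℝ] (Fin m → ℂ)) (hf : (⇑f) ∘ (⇑f) = id)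
    (h : Fin m → ℂ) (hh : h * h = 1)
    (hfi : f (fun _ => Complex.I) = (fun _ => Complex.I) * h) :
    f h = h := by
  have hI : (fun _ => Complex.I : Fin m → ℂ) = (fun _ => Complex.I) * h * f h := by
    rw [← hfi, ← map_mul, ← hfi]
    exact (congrFun hf _).symm
  have h_mul : h * f h = 1 := by
    funext j
    have hj := congrFun hI j
    simp only [Pi.mul_apply, mul_assoc] at hj
    exact mul_left_cancel₀ Complex.I_ne_zero (hj.symm.trans (mul_one _).symm)
  calc f h = h * h * f h := by rw [hh, one_mul]
    _ = h := by rw [mul_assoc, h_mul, mul_one]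
end
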